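/- arXiv:1206.1860 — 13 statements merged into one kernel-verified Lean document; each statement's English description precedes it below -/
import Mathlib

section
/- Let φ, φ₁, φ₂ be Orlicz functions and let C > 0. If C·φ₁⁻¹(u)·φ₂⁻¹(u) ≤ φ⁻¹(u) for all u > 0, then φ(C·u·v) ≤ φ₁(u) + φ₂(v) for all u, v > 0. -/
/-- An Orlicz function: convex, non-decreasing on `[0,∞)`, vanishing at `0`,
not identically zero on `(0,∞)`, and tending to `∞` at `∞`. -/
def IsOrlicz (φ : ℝ → ℝ) : Prop :=
  ConvexOn ℝ (Set.Ici 0) φ ∧ MonotoneOn φ (Set.Ici 0) ∧ φ 0 = 0 ∧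
    (∃ u : ℝ, 0 < u ∧ φ u ≠ 0) ∧ Filter.Tendsto φ Filter.atTop Filter.atTop

/-- The generalized right-continuous inverse `φ⁻¹(v) = inf {u ≥ 0 : φ(u) > v}`. -/
noncomputable def geninv (φ : ℝ → ℝ) (v : ℝ) : ℝ :=
  sInf {u : ℝ | 0 ≤ u ∧ v < φ u}

theorem le_geninv_aux (φ : ℝ → ℝ) (hφ : IsOrlicz φ) (u t : ℝ) (hu : 0 < u) (ht : φ u < t) :
    u ≤ geninv φ t := by
  obtain ⟨_, hm, _, _, hl⟩ := hφ
  apply le_csInf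
  · obtain ⟨x, hx1, hx2⟩ := ((hl.eventually_gt_atTop t).and (Filter.eventually_ge_atTop 0)).exists
    exact ⟨x, hx2, hx1⟩
  · rintro s ⟨hs, hts⟩
    by_contra! hsu
    have := hm (Set.mem_Ici.2 hs) (Set.mem_Ici.2 hu.le) hsu.le
    linarith

theorem stmt0 (φ φ₁ φ₂ : ℝ → ℝ) (C : ℝ)
    (hφ : IsOrlicz φ) (hφ₁ : IsOrlicz φ₁) (hφ₂ : IsOrlicz φ₂) (hC : 0 < C)
    (h : ∀ u : ℝ, 0 < u → C * geninv φ₁ u * geninv φ₂ u ≤ geninv φ u) :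
    ∀ u v : ℝ, 0 < u → 0 < v → φ (C * u * v) ≤ φ₁ u + φ₂ v := by
  intro u v hu hv
  have n1 : 0 ≤ φ₁ u := by
    have := hφ₁.2.1 (Set.mem_Ici.2 le_rfl) (Set.mem_Ici.2 hu.le) hu.le
    rwa [hφ₁.2.2.1] at this
  have n2 : 0 ≤ φ₂ v := by
    have := hφ₂.2.1 (Set.mem_Ici.2 le_rfl) (Set.mem_Ici.2 hv.le) hv.le
    rwa [hφ₂.2.2.1] at this
  by_contra! hlt
  obtain ⟨t, ht1, ht2⟩ := exists_between hlt
  have a1 := le_geninv_aux φ₁ hφ₁ u t hu (by linarith)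
  have a2 := le_geninv_aux φ₂ hφ₂ v t hv (by linarith)
  have hx : 0 < C * u * v := by positivity
  have hle : C * u * v ≤ geninv φ t := by
    refine le_trans ?_ (h t (by linarith))
    have a3 : 0 ≤ geninv φ₁ t := by linarith
    have a4 : 0 ≤ C * geninv φ₁ t := by positivity
    gcongr
  have hc : ContinuousAt φ (C * u * v) := by
    have h1 := hφ.1.continuousOn_interior
    rw [interior_Ici] at h1
    exact h1.continuousAt (Ioi_mem_nhds hx)
  have he := (hc.eventually (lt_mem_nhds ht2)).and (lt_mem_nhds hx)
  obtain ⟨s, ⟨hs1, hs2⟩, hs3⟩ :=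
    ((he.filter_mono (nhdsWithin_le_nhds (s := Set.Iio (C * u * v)))).and
      self_mem_nhdsWithin).exists
  have hs4 : geninv φ t ≤ s := csInf_le ⟨0, fun y hy => hy.1⟩ ⟨hs2.le, hs1⟩
  have hs5 : s < C * u * v := hs3
  linarith
end

section
/- Let φ, φ₁, φ₂ be Orlicz functions and let C > 0. If φ(C·u·v) ≤ φ₁(u) + φ₂(v) for all u, v > 0, then φ₁⁻¹(w)·φ₂⁻¹(w) ≤ (2/C)·φ⁻¹(w) for all w > 0. -/
theorem stmt1 (φ φ₁ φ₂ : ℝ → ℝ) (C : ℝ)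
    (hφ : IsOrlicz φ) (hφ₁ : IsOrlicz φ₁) (hφ₂ : IsOrlicz φ₂) (hC : 0 < C)
    (h : ∀ u v : ℝ, 0 < u → 0 < v → φ (C * u * v) ≤ φ₁ u + φ₂ v) :
    ∀ w : ℝ, 0 < w → geninv φ₁ w * geninv φ₂ w ≤ (2 / C) * geninv φ w := by
  intro w hw
  obtain ⟨hc, hm, h0, -, ht⟩ := hφ
  have key : ∀ (ψ : ℝ → ℝ) (u : ℝ), 0 ≤ u → u < geninv ψ w → ψ u ≤ w := by
    intro ψ u hu hlt
    by_contra hcon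
    push Not at hcon
    have : geninv ψ w ≤ u := csInf_le ⟨0, fun x hx => hx.1⟩ ⟨hu, hcon⟩
    linarith
  have nn : ∀ ψ : ℝ → ℝ, 0 ≤ geninv ψ w := fun ψ => Real.sInf_nonneg fun x hx => hx.1
  have ne : ({u : ℝ | 0 ≤ u ∧ w < φ u}).Nonempty := by
    obtain ⟨x, hx1, hx2⟩ :=
      ((Filter.eventually_ge_atTop (0:ℝ)).and (ht.eventually_gt_atTop w)).exists
    exact ⟨x, hx1, hx2⟩
  have main : ∀ u v : ℝ, 0 < u → 0 < v → u < geninv φ₁ w → v < geninv φ₂ w →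
      u * v ≤ 2 / C * geninv φ w := by
    intro u v hu hv hua hvb
    have h1 := h u v hu hv
    have h2 := key φ₁ u hu.le hua
    have h3 := key φ₂ v hv.le hvb
    have hpos : 0 < C * u * v := by positivity
    have h4 := hc.2 (Set.mem_Ici.2 (le_refl (0:ℝ))) (Set.mem_Ici.2 hpos.le)
      (by norm_num : (0:ℝ) ≤ 1 / 2) (by norm_num : (0:ℝ) ≤ 1 / 2) (by norm_num)
    simp only [smul_eq_mul, mul_zero, zero_add, h0] at h4
    have h5 : 1 / 2 * (C * u * v) ≤ geninv φ w := by
      refine le_csInf ne ?_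
      rintro x ⟨hx0, hx⟩
      by_contra hcon
      push Not at hcon
      have := hm (Set.mem_Ici.2 hx0) (Set.mem_Ici.2 (by positivity)) hcon.le
      linarith
    rw [div_mul_eq_mul_div, le_div_iff₀ hC]
    linarith
  have ha := nn φ₁
  have hb := nn φ₂
  have hg : 0 ≤ 2 / C * geninv φ w := mul_nonneg (by positivity) (nn φ)
  rcases ha.eq_or_lt with ha | ha
  · rw [← ha, zero_mul]; exact hg
  rcases hb.eq_or_lt with hb | hb
  · rw [← hb, mul_zero]; exact hg
  have hT : Filter.Tendsto (fun t : ℝ => (t * geninv φ₁ w) * (t * geninv φ₂ w))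
      (nhdsWithin 1 (Set.Iio 1)) (nhds (geninv φ₁ w * geninv φ₂ w)) := by
    have hcont : Continuous (fun t : ℝ => (t * geninv φ₁ w) * (t * geninv φ₂ w)) := by fun_prop
    have := (hcont.tendsto 1).mono_left (nhdsWithin_le_nhds (s := Set.Iio 1))
    simpa using this
  refine le_of_tendsto hT ?_
  filter_upwards [Ioo_mem_nhdsLT (zero_lt_one (α := ℝ))] with t ht'
  obtain ⟨t0, t1⟩ := ht'
  exact main _ _ (by positivity) (by positivity) (by nlinarith) (by nlinarith)
end

section
/- Let φ, φ₁, φ₂ be Orlicz functions that are strictly positive on (0,∞) (nondegenerate). Then the following two conditions are equivalent: (a) there exist u₀ > 0 and C₀ > 0 such that C₀·φ₁⁻¹(u)·φ₂⁻¹(u) ≤ φ⁻¹(u) for all u ≥ u₀; (b) there exist u₁ > 0 and C₁ > 0 such that φ(C₁·u·v) ≤ φ₁(u) + φ₂(v) for all u, v ≥ u₁. -/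
theorem le_geninv_aux_s2 {φ : ℝ → ℝ} (h : IsOrlicz φ) {x s : ℝ} (hx : 0 ≤ x) (hs : φ x ≤ s) :
    x ≤ geninv φ s := by
  obtain ⟨-, hm, -, -, ht⟩ := h
  unfold geninv
  apply le_csInf
  · obtain ⟨w, hw0, hw⟩ := ((Filter.eventually_ge_atTop (0:ℝ)).and
      (ht.eventually (Filter.eventually_gt_atTop s))).exists
    exact ⟨w, hw0, hw⟩
  · rintro w ⟨hw0, hw⟩
    by_contra hlt
    push Not at hlt
    have := hm (Set.mem_Ici.2 hw0) (Set.mem_Ici.2 hx) hlt.le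
    linarith

theorem le_of_lt_geninv_aux {φ : ℝ → ℝ} {x s : ℝ} (hx : 0 ≤ x) (hs : x < geninv φ s) :
    φ x ≤ s := by
  by_contra hlt
  push Not at hlt
  have : geninv φ s ≤ x := csInf_le ⟨0, fun w hw => hw.1⟩ ⟨hx, hlt⟩
  linarith

theorem half_aux {φ : ℝ → ℝ} (h : IsOrlicz φ) {x : ℝ} (hx : 0 ≤ x) : φ (x / 2) ≤ φ x / 2 := by
  obtain ⟨hc, -, h0, -, -⟩ := h
  have := hc.2 (Set.mem_Ici.2 hx) (Set.mem_Ici.2 (le_refl (0:ℝ)))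
    (show (0:ℝ) ≤ 1/2 by norm_num) (show (0:ℝ) ≤ 1/2 by norm_num) (by norm_num)
  simp only [smul_eq_mul, h0, mul_zero, add_zero] at this
  rw [show x / 2 = 1 / 2 * x by ring]
  linarith

theorem stmt2 (φ φ₁ φ₂ : ℝ → ℝ)
    (hφ : IsOrlicz φ) (hφ₁ : IsOrlicz φ₁) (hφ₂ : IsOrlicz φ₂)
    (hφpos : ∀ u : ℝ, 0 < u → 0 < φ u)
    (hφ₁pos : ∀ u : ℝ, 0 < u → 0 < φ₁ u)
    (hφ₂pos : ∀ u : ℝ, 0 < u → 0 < φ₂ u) :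
    (∃ u₀ : ℝ, 0 < u₀ ∧ ∃ C₀ : ℝ, 0 < C₀ ∧
      ∀ u : ℝ, u₀ ≤ u → C₀ * geninv φ₁ u * geninv φ₂ u ≤ geninv φ u) ↔
    (∃ u₁ : ℝ, 0 < u₁ ∧ ∃ C₁ : ℝ, 0 < C₁ ∧
      ∀ u v : ℝ, u₁ ≤ u → u₁ ≤ v → φ (C₁ * u * v) ≤ φ₁ u + φ₂ v) := by
  constructor
  · rintro ⟨u₀, hu₀, C, hC, H⟩
    obtain ⟨u₁, hu₁, h1⟩ := ((Filter.eventually_gt_atTop (0:ℝ)).and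
      (hφ₁.2.2.2.2.eventually (Filter.eventually_ge_atTop u₀))).exists
    refine ⟨u₁, hu₁, C / 2, by positivity, fun u v hu hv => ?_⟩
    have hu0 : 0 < u := by linarith
    have hv0 : 0 < v := by linarith
    have hm := hφ₁.2.1 (Set.mem_Ici.2 hu₁.le) (Set.mem_Ici.2 hu0.le) hu
    have hp1 := hφ₁pos u hu0
    have hp2 := hφ₂pos v hv0
    set s := max (φ₁ u) (φ₂ v) with hs
    have hs1 : φ₁ u ≤ s := le_max_left _ _
    have hs2 : φ₂ v ≤ s := le_max_right _ _
    have ha := le_geninv_aux_s2 hφ₁ hu0.le hs1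
    have hb := le_geninv_aux_s2 hφ₂ hv0.le hs2
    have hH := H s (by linarith)
    have hmul : u * v ≤ geninv φ₁ s * geninv φ₂ s :=
      mul_le_mul ha hb hv0.le (hu0.le.trans ha)
    have hmul2 := mul_le_mul_of_nonneg_left hmul hC.le
    have hpos : 0 < C * (u * v) := by positivity
    have key : φ (C / 2 * u * v) ≤ s := by
      apply le_of_lt_geninv_aux (by positivity)
      linarith
    have : s ≤ φ₁ u + φ₂ v := max_le (by linarith) (by linarith)
    linarith
  · rintro ⟨u₁, hu₁, C, hC, H⟩
    refine ⟨max (φ₁ (2 * u₁)) (φ₂ (2 * u₁)),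
      lt_max_of_lt_left (hφ₁pos _ (by positivity)), C / 8, by positivity, fun s hs => ?_⟩
    have ha := le_geninv_aux_s2 hφ₁ (by positivity) ((le_max_left _ _).trans hs)
    have hb := le_geninv_aux_s2 hφ₂ (by positivity) ((le_max_right _ _).trans hs)
    have ha' : φ₁ (geninv φ₁ s / 2) ≤ s := le_of_lt_geninv_aux (by linarith) (by linarith)
    have hb' : φ₂ (geninv φ₂ s / 2) ≤ s := le_of_lt_geninv_aux (by linarith) (by linarith)
    have hH := H (geninv φ₁ s / 2) (geninv φ₂ s / 2) (by linarith) (by linarith)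
    have ha0 : 0 < geninv φ₁ s := by linarith
    have hb0 : 0 < geninv φ₂ s := by linarith
    apply le_geninv_aux_s2 hφ (by positivity)
    have hh := half_aux hφ (x := C * (geninv φ₁ s / 2) * (geninv φ₂ s / 2)) (by positivity)
    rw [show C / 8 * geninv φ₁ s * geninv φ₂ s
      = C * (geninv φ₁ s / 2) * (geninv φ₂ s / 2) / 2 by ring]
    linarith
end

section
/- Let φ, φ₁, φ₂ be Orlicz functions and suppose there exist constants C, D, u₀ > 0 such that C·φ₁⁻¹(u)·φ₂⁻¹(u) ≤ φ⁻¹(u) ≤ D·φ₁⁻¹(u)·φ₂⁻¹(u) for all 0 < u ≤ u₀. Then a_φ = 0 if and only if a_{φ₁} = 0 or a_{φ₂} = 0, where a_ψ = sup{u ≥ 0 : ψ(u) = 0} for an Orlicz function ψ. -/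
open Filter Topology in
theorem geninv_tendsto (φ : ℝ → ℝ) (hφ : IsOrlicz φ) :
    0 ≤ sSup {u : ℝ | 0 ≤ u ∧ φ u = 0} ∧
    Tendsto (geninv φ) (𝓝[>] 0) (𝓝 (sSup {u : ℝ | 0 ≤ u ∧ φ u = 0})) := by
  obtain ⟨-, hm, h0, -, ht⟩ := hφ
  set S := {u : ℝ | 0 ≤ u ∧ φ u = 0} with hS
  have key : ∀ u v : ℝ, 0 ≤ u → 0 < v → v < φ u → ∀ z ∈ S, z ≤ u := by
    intro u v hu hv hvu z hz
    by_contra! hlt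
    have := hm (Set.mem_Ici.2 hu) (Set.mem_Ici.2 hz.1) hlt.le
    rw [hz.2] at this
    linarith
  have hex : ∀ v : ℝ, ∃ u : ℝ, 0 ≤ u ∧ v < φ u := fun v =>
    ((eventually_ge_atTop 0).and (ht.eventually_gt_atTop v)).exists
  have hne : S.Nonempty := ⟨0, le_rfl, h0⟩
  have hbdd : BddAbove S := by
    obtain ⟨u, hu, hvu⟩ := hex 1
    exact ⟨u, fun z hz => key u 1 hu one_pos hvu z hz⟩
  have hn : 0 ≤ sSup S := le_csSup hbdd ⟨le_rfl, h0⟩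
  refine ⟨hn, ?_⟩
  rw [tendsto_order]
  constructor
  · intro b hb
    filter_upwards [self_mem_nhdsWithin] with v hv
    refine hb.trans_le (le_csInf (hex v) ?_)
    rintro u ⟨hu, hvu⟩
    exact csSup_le hne (key u v hu hv hvu)
  · intro b hb
    obtain ⟨c, hc1, hc2⟩ := exists_between hb
    have hc0 : 0 ≤ c := hn.trans hc1.le
    have hpos : 0 < φ c := by
      have h1 := hm (Set.mem_Ici.2 le_rfl) (Set.mem_Ici.2 hc0) hc0
      rw [h0] at h1
      refine lt_of_le_of_ne h1 fun h2 => ?_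
      exact absurd (le_csSup hbdd ⟨hc0, h2.symm⟩) (not_le.2 hc1)
    filter_upwards [Ioo_mem_nhdsGT hpos] with v hv
    exact (csInf_le ⟨0, fun u hu => hu.1⟩ ⟨hc0, hv.2⟩ : geninv φ v ≤ c).trans_lt hc2

theorem stmt5 (φ φ₁ φ₂ : ℝ → ℝ)
    (hφ : IsOrlicz φ) (hφ₁ : IsOrlicz φ₁) (hφ₂ : IsOrlicz φ₂)
    (C D u₀ : ℝ) (hC : 0 < C) (hD : 0 < D) (hu₀ : 0 < u₀)
    (h : ∀ u : ℝ, 0 < u → u ≤ u₀ →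
      C * geninv φ₁ u * geninv φ₂ u ≤ geninv φ u ∧
      geninv φ u ≤ D * geninv φ₁ u * geninv φ₂ u) :
    sSup {u : ℝ | 0 ≤ u ∧ φ u = 0} = 0 ↔
      (sSup {u : ℝ | 0 ≤ u ∧ φ₁ u = 0} = 0 ∨ sSup {u : ℝ | 0 ≤ u ∧ φ₂ u = 0} = 0) := by
  obtain ⟨n, t⟩ := geninv_tendsto φ hφ
  obtain ⟨n1, t1⟩ := geninv_tendsto φ₁ hφ₁
  obtain ⟨n2, t2⟩ := geninv_tendsto φ₂ hφ₂
  have hev : ∀ᶠ u in nhdsWithin (0 : ℝ) (Set.Ioi 0),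
      C * geninv φ₁ u * geninv φ₂ u ≤ geninv φ u ∧
      geninv φ u ≤ D * geninv φ₁ u * geninv φ₂ u := by
    filter_upwards [Ioo_mem_nhdsGT hu₀] with u hu
    exact h u hu.1 hu.2.le
  have hl := le_of_tendsto_of_tendsto ((t1.const_mul C).mul t2) t (hev.mono fun _ h => h.1)
  have hr := le_of_tendsto_of_tendsto t ((t1.const_mul D).mul t2) (hev.mono fun _ h => h.2)
  constructor
  · intro ha
    rw [ha, mul_assoc] at hl
    have h3 := le_antisymm (nonpos_of_mul_nonpos_right hl hC) (mul_nonneg n1 n2)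
    exact mul_eq_zero.1 h3
  · rintro (ha | ha)
    · rw [ha] at hr
      exact le_antisymm (by simpa using hr) n
    · rw [ha] at hr
      exact le_antisymm (by simpa using hr) n
end

section
/- Let φ, φ₁ be Orlicz functions and define φ₂ = φ ⊖ φ₁ : [0,∞) → [0,∞] by φ₂(u) = sup_{v>0} [φ(u·v) − φ₁(v)]. Then: (i) φ₂(0) = 0; (ii) φ₂ is non-decreasing; (iii) φ₂ is convex, i.e., for all u, w ≥ 0 and t ∈ [0,1] one has φ₂(t·u + (1−t)·w) ≤ t·φ₂(u) + (1−t)·φ₂(w) (with arithmetic in [0,∞], where 0·∞ = 0); (iv) φ₂ is left-continuous at every u₀ > 0, i.e., φ₂(u) → φ₂(u₀) in [0,∞] as u → u₀ from the left. -/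
open scoped ENNReal

/-- Ando's complementary function `(φ ⊖ φ₁)(u) = sup_{v>0} [φ(uv) − φ₁(v)]`,
with values in `[0,∞]` (the possibly negative values are truncated at `0`,
which does not change the supremum since it is nonnegative). -/
noncomputable def ominus (φ φ₁ : ℝ → ℝ) (u : ℝ) : ℝ≥0∞ :=
  ⨆ v ∈ Set.Ioi (0 : ℝ), ENNReal.ofReal (φ (u * v) - φ₁ v)

theorem stmt6 (φ φ₁ : ℝ → ℝ) (hφ : IsOrlicz φ) (hφ₁ : IsOrlicz φ₁) :
    (ominus φ φ₁ 0 = 0) ∧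
    (∀ u w : ℝ, 0 ≤ u → u ≤ w → ominus φ φ₁ u ≤ ominus φ φ₁ w) ∧
    (∀ u w t : ℝ, 0 ≤ u → 0 ≤ w → 0 ≤ t → t ≤ 1 →
      ominus φ φ₁ (t * u + (1 - t) * w) ≤
        ENNReal.ofReal t * ominus φ φ₁ u + ENNReal.ofReal (1 - t) * ominus φ φ₁ w) ∧
    (∀ u₀ : ℝ, 0 < u₀ →
      Filter.Tendsto (ominus φ φ₁) (nhdsWithin u₀ (Set.Iio u₀)) (nhds (ominus φ φ₁ u₀))) := by
  obtain ⟨hc, hm, h0, -, -⟩ := hφ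
  obtain ⟨-, hm₁, h0₁, -, -⟩ := hφ₁
  have hmono : ∀ u w : ℝ, 0 ≤ u → u ≤ w → ominus φ φ₁ u ≤ ominus φ φ₁ w := by
    intro u w hu huw
    unfold ominus
    refine iSup₂_mono fun v hv => ENNReal.ofReal_le_ofReal ?_
    have hv : 0 < v := hv
    have : φ (u * v) ≤ φ (w * v) :=
      hm (Set.mem_Ici.2 (by positivity)) (Set.mem_Ici.2 (mul_nonneg (hu.trans huw) hv.le))
        (mul_le_mul_of_nonneg_right huw hv.le)
    linarith
  have hle : ∀ u v : ℝ, 0 < v → ENNReal.ofReal (φ (u * v) - φ₁ v) ≤ ominus φ φ₁ u := by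
    intro u v hv
    unfold ominus
    exact le_iSup₂ (f := fun v (_ : v ∈ Set.Ioi (0 : ℝ)) =>
      ENNReal.ofReal (φ (u * v) - φ₁ v)) v hv
  refine ⟨?_, hmono, ?_, ?_⟩
  · unfold ominus
    simp only [ENNReal.iSup_eq_zero, ENNReal.ofReal_eq_zero]
    intro v hv
    have hv : 0 < v := hv
    have := hm₁ (Set.mem_Ici.2 le_rfl) (Set.mem_Ici.2 hv.le) hv.le
    rw [zero_mul, h0]
    linarith
  · intro u w t hu hw ht ht1
    have ht2 : 0 ≤ 1 - t := by linarith
    conv_lhs => unfold ominus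
    refine iSup₂_le fun v hv => ?_
    have hv : 0 < v := hv
    have key := hc.2 (Set.mem_Ici.2 (mul_nonneg hu hv.le)) (Set.mem_Ici.2 (mul_nonneg hw hv.le))
      ht ht2 (by ring)
    simp only [smul_eq_mul] at key
    calc ENNReal.ofReal (φ ((t * u + (1 - t) * w) * v) - φ₁ v)
        ≤ ENNReal.ofReal (t * (φ (u * v) - φ₁ v) + (1 - t) * (φ (w * v) - φ₁ v)) := by
          apply ENNReal.ofReal_le_ofReal
          have e : (t * u + (1 - t) * w) * v = t * (u * v) + (1 - t) * (w * v) := by ring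
          rw [e]
          linarith
      _ ≤ ENNReal.ofReal (t * (φ (u * v) - φ₁ v))
          + ENNReal.ofReal ((1 - t) * (φ (w * v) - φ₁ v)) := ENNReal.ofReal_add_le
      _ = ENNReal.ofReal t * ENNReal.ofReal (φ (u * v) - φ₁ v)
          + ENNReal.ofReal (1 - t) * ENNReal.ofReal (φ (w * v) - φ₁ v) := by
          rw [ENNReal.ofReal_mul ht, ENNReal.ofReal_mul ht2]
      _ ≤ _ := by
          gcongr
          · exact hle u v hv
          · exact hle w v hv
  · intro u₀ hu₀
    refine tendsto_order.2 ⟨fun a ha => ?_, fun a ha => ?_⟩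
    · have ha' := ha
      unfold ominus at ha'
      obtain ⟨v, ha'⟩ := lt_iSup_iff.1 ha'
      obtain ⟨hv, ha'⟩ := lt_iSup_iff.1 ha'
      have hv : 0 < v := hv
      have hcont : ContinuousOn φ (Set.Ioi 0) :=
        (hc.subset Set.Ioi_subset_Ici_self (convex_Ioi 0)).continuousOn isOpen_Ioi
      have hat : ContinuousAt φ (u₀ * v) := hcont.continuousAt (Ioi_mem_nhds (by positivity))
      have hcomp : ContinuousAt (fun u => φ (u * v)) u₀ :=
        ContinuousAt.comp (f := fun u : ℝ => u * v) (g := φ) hat (by fun_prop)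
      have hF : ContinuousAt (fun u => ENNReal.ofReal (φ (u * v) - φ₁ v)) u₀ :=
        ENNReal.continuous_ofReal.continuousAt.comp (hcomp.sub continuousAt_const)
      have hev := hF.eventually (lt_mem_nhds ha')
      filter_upwards [nhdsWithin_le_nhds hev] with u hu
      exact lt_of_lt_of_le hu (hle u v hv)
    · filter_upwards [self_mem_nhdsWithin, nhdsWithin_le_nhds (Ioi_mem_nhds hu₀)] with u h1 h2
      exact lt_of_le_of_lt (hmono u u₀ (le_of_lt h2) (le_of_lt h1)) ha
end

section
/- Let φ, φ₁ be Orlicz functions and let φ₂ = φ ⊖ φ₁, with generalized inverse φ₂⁻¹(v) = inf{w ≥ 0 : φ₂(w) > v}. Then φ₁⁻¹(u)·φ₂⁻¹(u) ≤ 2·φ⁻¹(u) for all u ≥ 0. -/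
open scoped ENNReal

/-- The generalized inverse of a `[0,∞]`-valued function:
`Φ⁻¹(v) = inf {w ≥ 0 : Φ(w) > v}`. -/
noncomputable def geninvE (Φ : ℝ → ℝ≥0∞) (v : ℝ) : ℝ :=
  sInf {w : ℝ | 0 ≤ w ∧ ENNReal.ofReal v < Φ w}

theorem stmt7 (φ φ₁ : ℝ → ℝ) (hφ : IsOrlicz φ) (hφ₁ : IsOrlicz φ₁) :
    ∀ u : ℝ, 0 ≤ u →
      geninv φ₁ u * geninvE (ominus φ φ₁) u ≤ 2 * geninv φ u := by
  intro u hu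
  obtain ⟨hconv, hmono, h0, -, htend⟩ := hφ
  by_contra hcon
  push Not at hcon
  have ha : 0 ≤ geninv φ₁ u := Real.sInf_nonneg (fun x hx => hx.1)
  have hb : 0 ≤ geninvE (ominus φ φ₁) u := Real.sInf_nonneg (fun x hx => hx.1)
  have hc : 0 ≤ geninv φ u := Real.sInf_nonneg (fun x hx => hx.1)
  have hb' : 0 < geninvE (ominus φ φ₁) u := by
    rcases hb.eq_or_lt with h | h
    · rw [← h] at hcon; linarith
    · exact h
  obtain ⟨s, hs1, hs2⟩ := exists_between ((div_lt_iff₀ hb').2 hcon)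
  have hs0 : 0 < s := lt_of_le_of_lt (by positivity) hs1
  rw [div_lt_iff₀ hb', mul_comm s, ← div_lt_iff₀ hs0] at hs1
  obtain ⟨t, ht1, ht2⟩ := exists_between hs1
  have ht0 : 0 < t := lt_of_le_of_lt (by positivity) ht1
  rw [div_lt_iff₀ hs0] at ht1
  have h1 : φ₁ s ≤ u := by
    by_contra h
    push Not at h
    exact notMem_of_lt_csInf hs2 ⟨0, fun x hx => hx.1⟩ ⟨hs0.le, h⟩
  have h2 : ominus φ φ₁ t ≤ ENNReal.ofReal u := by
    by_contra h
    push Not at h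
    exact notMem_of_lt_csInf ht2 ⟨0, fun x hx => hx.1⟩ ⟨ht0.le, h⟩
  have h3 : φ (t * s) - φ₁ s ≤ u := by
    rw [← ENNReal.ofReal_le_ofReal_iff hu]
    refine le_trans ?_ h2
    exact le_iSup₂ (f := fun v (_ : v ∈ Set.Ioi (0 : ℝ)) =>
      ENNReal.ofReal (φ (t * v) - φ₁ v)) s hs0
  have hne : {x : ℝ | 0 ≤ x ∧ u < φ x}.Nonempty := by
    obtain ⟨x, hx⟩ := ((Filter.eventually_ge_atTop 0).and
      (htend.eventually_gt_atTop u)).exists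
    exact ⟨x, hx⟩
  have h4 : sInf {x : ℝ | 0 ≤ x ∧ u < φ x} < t * s / 2 := by
    change geninv φ u < _
    linarith
  obtain ⟨w, ⟨hw0, hw⟩, hwlt⟩ := exists_lt_of_csInf_lt hne h4
  have hts : 0 ≤ t * s := by positivity
  have h5 : φ w ≤ φ (t * s / 2) :=
    hmono hw0 (show (0 : ℝ) ≤ t * s / 2 by positivity) hwlt.le
  have h6 := hconv.2 (show (0 : ℝ) ∈ Set.Ici 0 from Set.self_mem_Ici) (show t * s ∈ Set.Ici 0 from hts)
    (show (0 : ℝ) ≤ 1 / 2 by norm_num) (show (0 : ℝ) ≤ 1 / 2 by norm_num) (by norm_num)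
  simp only [smul_eq_mul, h0, mul_zero, zero_add] at h6
  rw [show 1 / 2 * (t * s) = t * s / 2 by ring] at h6
  linarith
end

section
/- Let φ, φ₁ be Orlicz functions that are strictly positive on (0,∞), and suppose there is a constant K ≥ 1 such that for every v > 0 there exists a non-decreasing function ψ_v : (0,∞) → (0,∞) with (1/K)·ψ_v(u) ≤ φ₁(u)/φ(u·v) ≤ K·ψ_v(u) for all u > 0. Then, with φ₂ = φ ⊖ φ₁, one has φ⁻¹(u) ≤ K²·φ₁⁻¹(u)·φ₂⁻¹(u) for all u > 0. -/
open scoped ENNReal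

theorem stmt8 (φ φ₁ : ℝ → ℝ) (hφ : IsOrlicz φ) (hφ₁ : IsOrlicz φ₁)
    (hφpos : ∀ u : ℝ, 0 < u → 0 < φ u) (hφ₁pos : ∀ u : ℝ, 0 < u → 0 < φ₁ u)
    (K : ℝ) (hK : 1 ≤ K)
    (h : ∀ v : ℝ, 0 < v → ∃ ψ : ℝ → ℝ, MonotoneOn ψ (Set.Ioi 0) ∧
      (∀ u : ℝ, 0 < u → 0 < ψ u) ∧
      (∀ u : ℝ, 0 < u →
        (1 / K) * ψ u ≤ φ₁ u / φ (u * v) ∧ φ₁ u / φ (u * v) ≤ K * ψ u)) :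
    ∀ u : ℝ, 0 < u →
      geninv φ u ≤ K ^ 2 * geninv φ₁ u * geninvE (ominus φ φ₁) u := by
  intro u hu
  obtain ⟨hc, hm, h0, -, ht⟩ := hφ
  obtain ⟨-, hm1, -, -, ht1⟩ := hφ₁
  have hinv : ∀ x : ℝ, 0 ≤ x → u < φ x → geninv φ u ≤ x := by
    intro x hx hux
    exact csInf_le ⟨0, fun y hy => hy.1⟩ ⟨hx, hux⟩
  have hb0 : 0 ≤ geninv φ₁ u := Real.sInf_nonneg (fun y hy => hy.1)
  have hb : ∀ t : ℝ, geninv φ₁ u < t → u < φ₁ t := by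
    intro t htb
    have hne : {x : ℝ | 0 ≤ x ∧ u < φ₁ x}.Nonempty := by
      obtain ⟨x, hx1, hx2⟩ := ((Filter.eventually_ge_atTop (0:ℝ)).and
        (ht1.eventually_gt_atTop u)).exists
      exact ⟨x, hx1, hx2⟩
    obtain ⟨s, ⟨hs0, hs1⟩, hst⟩ := exists_lt_of_csInf_lt hne htb
    exact lt_of_lt_of_le hs1 (hm1 hs0 (le_trans hs0 hst.le) hst.le)
  have hK2 : 1 ≤ K ^ 2 := one_le_pow₀ hK
  have hK0 : 0 < K := by linarith
  have hconv : ∀ x : ℝ, 0 ≤ x → K ^ 2 * φ x ≤ φ (K ^ 2 * x) := by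
    intro x hx
    have hinvle : (K ^ 2)⁻¹ ≤ 1 := inv_le_one_of_one_le₀ hK2
    have hx' : K ^ 2 * x ∈ Set.Ici (0:ℝ) := by
      simp only [Set.mem_Ici]
      positivity
    have h0' : (0:ℝ) ∈ Set.Ici (0:ℝ) := by simp
    have ha : 0 ≤ (K ^ 2)⁻¹ := by positivity
    have hb' : 0 ≤ 1 - (K ^ 2)⁻¹ := by linarith
    have hh := hc.2 hx' h0' ha hb' (by ring)
    simp only [smul_eq_mul, mul_zero, add_zero, h0] at hh
    rw [inv_mul_cancel_left₀ (by positivity)] at hh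
    rwa [← div_eq_inv_mul, le_div_iff₀ (by positivity), mul_comm] at hh
  have key : ∀ w : ℝ, 0 ≤ w → ENNReal.ofReal u < ominus φ φ₁ w →
      ∀ t : ℝ, geninv φ₁ u < t → geninv φ u ≤ K ^ 2 * t * w := by
    intro w hw hlt t htb
    have ht0 : 0 < t := lt_of_le_of_lt hb0 htb
    unfold ominus at hlt
    simp only [lt_iSup_iff] at hlt
    obtain ⟨v, hv, hlt⟩ := hlt
    have hv : 0 < v := hv
    rw [ENNReal.ofReal_lt_ofReal_iff_of_nonneg hu.le] at hlt
    have hv1 := hφ₁pos v hv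
    have hw0 : 0 < w := by
      rcases hw.eq_or_lt with rfl | h'
      · rw [zero_mul, h0] at hlt; linarith
      · exact h'
    rcases le_or_gt v t with hvt | hvt
    · have h1 := hinv (w * v) (by positivity) (by linarith)
      have h2 : w * v ≤ w * t := by gcongr
      have h3 : 1 * (w * t) ≤ K ^ 2 * (w * t) := by gcongr
      linarith
    · obtain ⟨ψ, hψm, hψp, hψ⟩ := h w hw0
      have h1 := (hψ t ht0).2
      have h2 := (hψ v hv).1
      have h3 := hψm ht0 hv hvt.le
      have h4 : φ₁ v / φ (v * w) < 1 := by
        rw [div_lt_one (hφpos _ (by positivity)), mul_comm v w]; linarith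
      have h5 : ψ v ≤ K := by
        rw [one_div, ← div_eq_inv_mul, div_le_iff₀ hK0] at h2
        nlinarith
      have h6 : φ₁ t / φ (t * w) ≤ K ^ 2 := by nlinarith
      rw [div_le_iff₀ (hφpos _ (by positivity))] at h6
      have h7 := hconv (t * w) (by positivity)
      have h8 := hb t htb
      rw [mul_assoc]
      exact hinv _ (by positivity) (by linarith)
  have key2 : ∀ w : ℝ, 0 ≤ w → ENNReal.ofReal u < ominus φ φ₁ w →
      geninv φ u ≤ K ^ 2 * geninv φ₁ u * w := by
    intro w hw hlt
    have hcont : Filter.Tendsto (fun t : ℝ => K ^ 2 * t * w)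
        (nhdsWithin (geninv φ₁ u) (Set.Ioi (geninv φ₁ u)))
        (nhds (K ^ 2 * geninv φ₁ u * w)) := by
      apply Filter.Tendsto.mono_left _ nhdsWithin_le_nhds
      exact Continuous.tendsto (by fun_prop) _
    refine ge_of_tendsto hcont ?_
    filter_upwards [self_mem_nhdsWithin] with t htb
    exact key w hw hlt t htb
  have hne : {w : ℝ | 0 ≤ w ∧ ENNReal.ofReal u < ominus φ φ₁ w}.Nonempty := by
    obtain ⟨x, hx1, hx2⟩ := ((Filter.eventually_ge_atTop (0:ℝ)).and
      (ht.eventually_gt_atTop (u + φ₁ 1))).exists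
    refine ⟨x, hx1, ?_⟩
    unfold ominus
    simp only [lt_iSup_iff]
    refine ⟨1, by simp, ?_⟩
    rw [ENNReal.ofReal_lt_ofReal_iff_of_nonneg hu.le, mul_one]
    linarith
  rcases hb0.eq_or_lt with hz | hp
  · obtain ⟨w, hw, hlt⟩ := hne
    have := key2 w hw hlt
    rw [← hz] at this ⊢
    simpa using this
  · have hpos : 0 < K ^ 2 * geninv φ₁ u := by positivity
    rw [← div_le_iff₀' hpos]
    refine le_csInf hne ?_
    rintro w ⟨hw, hlt⟩
    rw [div_le_iff₀' hpos]
    exact key2 w hw hlt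
end

section
/- Let φ(u) = max(u − 1, 0) for u ≥ 0, and let φ₃ : [0,∞) → [0,∞) be defined by φ₃(u) = 0 for 0 ≤ u ≤ 1/2, φ₃(u) = 2u − 1 for 1/2 ≤ u ≤ 1, and φ₃(u) = u² for u ≥ 1. Then for every u ≥ 0, sup_{v>0} [ φ(u·v) − φ₃(v) ] equals 0 if 0 ≤ u ≤ 2, and equals u²/4 − 1 if u ≥ 2. -/
theorem stmt11 (φ₃ : ℝ → ℝ)
    (h₁ : ∀ v : ℝ, 0 ≤ v → v ≤ 1 / 2 → φ₃ v = 0)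
    (h₂ : ∀ v : ℝ, 1 / 2 ≤ v → v ≤ 1 → φ₃ v = 2 * v - 1)
    (h₃ : ∀ v : ℝ, 1 ≤ v → φ₃ v = v ^ 2) :
    ∀ u : ℝ, 0 ≤ u →
      (u ≤ 2 →
        IsLUB {x : ℝ | ∃ v : ℝ, 0 < v ∧ x = max (u * v - 1) 0 - φ₃ v} 0) ∧
      (2 ≤ u →
        IsLUB {x : ℝ | ∃ v : ℝ, 0 < v ∧ x = max (u * v - 1) 0 - φ₃ v}
          (u ^ 2 / 4 - 1)) := by
  intro u hu
  refine ⟨fun hu2 => ?_, fun hu2 => ?_⟩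
  · apply IsGreatest.isLUB
    refine ⟨⟨1 / 2, by norm_num, ?_⟩, ?_⟩
    · rw [h₁ (1 / 2) (by norm_num) le_rfl, max_eq_right (by linarith)]
      norm_num
    · rintro x ⟨v, hv, rfl⟩
      have huv : u * v ≤ 2 * v := mul_le_mul_of_nonneg_right hu2 hv.le
      rw [sub_nonpos]
      rcases le_total v (1 / 2) with h | h
      · rw [h₁ v hv.le h]
        exact max_le (by linarith) le_rfl
      rcases le_total v 1 with h' | h'
      · rw [h₂ v h h']
        exact max_le (by linarith) (by linarith)
      · rw [h₃ v h']
        exact max_le (by nlinarith [sq_nonneg (v - 1)]) (sq_nonneg v)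
  · apply IsGreatest.isLUB
    refine ⟨⟨u / 2, by linarith, ?_⟩, ?_⟩
    · rw [h₃ (u / 2) (by linarith), max_eq_left (by nlinarith)]
      ring
    · rintro x ⟨v, hv, rfl⟩
      have hq : 0 ≤ u ^ 2 / 4 - 1 := by nlinarith
      rw [sub_le_iff_le_add]
      rcases le_total v (1 / 2) with h | h
      · rw [h₁ v hv.le h]
        exact max_le (by nlinarith) (by linarith)
      rcases le_total v 1 with h' | h'
      · rw [h₂ v h h']
        refine max_le ?_ (by linarith)
        have := mul_nonneg (sub_nonneg.2 hu2) (sub_nonneg.2 h')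
        nlinarith [sq_nonneg (u - 2)]
      · rw [h₃ v h']
        exact max_le (by nlinarith [sq_nonneg (u / 2 - v)]) (by nlinarith)
end

section
/- Let 1 ≤ p ≤ 2 and let φ_p : [0,∞) → [0,∞) be defined by φ_p(v) = v^p for 0 ≤ v ≤ 1 and φ_p(v) = v⁴ for v ≥ 1. Then for every u ≥ 0, sup_{v>0} [ (u·v)² − φ_p(v) ] equals 0 if 0 ≤ u ≤ 1, equals u² − 1 if 1 ≤ u ≤ √2, and equals u⁴/4 if u ≥ √2. -/
theorem stmt13 (p : ℝ) (hp1 : 1 ≤ p) (hp2 : p ≤ 2)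
    (φp : ℝ → ℝ)
    (h₁ : ∀ v : ℝ, 0 ≤ v → v ≤ 1 → φp v = v ^ p)
    (h₂ : ∀ v : ℝ, 1 ≤ v → φp v = v ^ (4 : ℕ)) :
    ∀ u : ℝ, 0 ≤ u →
      (u ≤ 1 →
        IsLUB {x : ℝ | ∃ v : ℝ, 0 < v ∧ x = (u * v) ^ (2 : ℕ) - φp v} 0) ∧
      (1 ≤ u → u ≤ Real.sqrt 2 →
        IsLUB {x : ℝ | ∃ v : ℝ, 0 < v ∧ x = (u * v) ^ (2 : ℕ) - φp v}
          (u ^ (2 : ℕ) - 1)) ∧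
      (Real.sqrt 2 ≤ u →
        IsLUB {x : ℝ | ∃ v : ℝ, 0 < v ∧ x = (u * v) ^ (2 : ℕ) - φp v}
          (u ^ (4 : ℕ) / 4)) := by
  have key : ∀ v : ℝ, 0 < v → v ≤ 1 → v ^ 2 ≤ φp v := by
    intro v hv hv1
    rw [h₁ v hv.le hv1, ← Real.rpow_natCast]
    exact Real.rpow_le_rpow_of_exponent_ge hv hv1 (by exact_mod_cast hp2)
  have h11 : φp 1 = 1 := by rw [h₂ 1 le_rfl]; norm_num
  have hs : Real.sqrt 2 ^ 2 = 2 := Real.sq_sqrt (by norm_num)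
  have hs0 : 0 < Real.sqrt 2 := Real.sqrt_pos.mpr (by norm_num)
  intro u hu
  refine ⟨fun hu1 => ⟨?_, ?_⟩, fun hu1 hu2 => IsGreatest.isLUB ⟨?_, ?_⟩,
    fun hu2 => IsGreatest.isLUB ⟨?_, ?_⟩⟩
  · rintro x ⟨v, hv, rfl⟩
    have hu2 : u ^ 2 ≤ 1 := by nlinarith
    have h : u ^ 2 * v ^ 2 ≤ 1 * v ^ 2 := mul_le_mul_of_nonneg_right hu2 (sq_nonneg v)
    rcases le_total v 1 with h1 | h1
    · have := key v hv h1
      nlinarith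
    · rw [h₂ v h1]
      have : 1 ≤ v ^ 2 := by nlinarith
      nlinarith
  · intro b hb
    by_contra! hb0
    have hm : 0 < min 1 (-b / 2) := lt_min one_pos (by linarith)
    have h1 : min 1 (-b / 2) ≤ 1 := min_le_left _ _
    have h2 : min 1 (-b / 2) ≤ -b / 2 := min_le_right _ _
    generalize min 1 (-b / 2) = v at hm h1 h2
    have h3 := hb ⟨v, hm, rfl⟩
    rw [h₁ v hm.le h1] at h3
    have h4 : v ^ p ≤ v ^ (1 : ℝ) := Real.rpow_le_rpow_of_exponent_ge hm h1 hp1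
    rw [Real.rpow_one] at h4
    have := sq_nonneg (u * v)
    linarith
  · exact ⟨1, one_pos, by rw [h11]; ring⟩
  · rintro x ⟨v, hv, rfl⟩
    have h3 : u ^ 2 ≤ 2 := by nlinarith
    have h4 : 1 ≤ u ^ 2 := by nlinarith
    rcases le_total v 1 with h1 | h1
    · have := key v hv h1
      have h5 : v ^ 2 ≤ 1 := by nlinarith
      nlinarith [mul_nonneg (sub_nonneg.2 h4) (sub_nonneg.2 h5)]
    · rw [h₂ v h1]
      have h5 : 1 ≤ v ^ 2 := by nlinarith
      nlinarith [mul_nonneg (sub_nonneg.2 h5) (show 0 ≤ v ^ 2 + 1 - u ^ 2 by linarith)]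
  · refine ⟨u / Real.sqrt 2, div_pos (by linarith) hs0, ?_⟩
    rw [h₂ _ ((one_le_div hs0).2 hu2), mul_pow, div_pow, div_pow, hs,
      show Real.sqrt 2 ^ 4 = (Real.sqrt 2 ^ 2) ^ 2 by ring, hs]
    ring
  · rintro x ⟨v, hv, rfl⟩
    rcases le_total v 1 with h1 | h1
    · have := key v hv h1
      have h4 : 1 ≤ u ^ 2 := by nlinarith
      have h5 : v ^ 2 ≤ 1 := by nlinarith
      nlinarith [mul_nonneg (sub_nonneg.2 h4) (sub_nonneg.2 h5), sq_nonneg (u ^ 2 - 2)]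
    · rw [h₂ v h1]
      nlinarith [sq_nonneg (u ^ 2 / 2 - v ^ 2)]
end

section
/- Let θ : [0,∞) → [0,∞) be defined by θ(v) = 0 for 0 ≤ v ≤ 1, θ(v) = v² − 1 for 1 ≤ v ≤ √2, and θ(v) = v⁴/4 for v ≥ √2. Then for every u ≥ 0, sup_{v>0} [ (u·v)² − θ(v) ] equals u² if 0 ≤ u ≤ 1, and equals u⁴ if u ≥ 1. In particular, for φ(u) = u² and φ_p(v) = v^p on [0,1], v⁴ on [1,∞) with 1 ≤ p < 2, the identity φ ⊖ (φ ⊖ φ_p) = φ_p fails on (0,1). -/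
/-- Ando's complementary operation (real-valued version, via `sSup`):
`(φ ⊖ ψ)(u) = sup_{v>0} [φ(u·v) − ψ(v)]`. -/
noncomputable def ominusR (φ ψ : ℝ → ℝ) (u : ℝ) : ℝ :=
  sSup {x : ℝ | ∃ v : ℝ, 0 < v ∧ x = φ (u * v) - ψ v}

theorem part_one (θ : ℝ → ℝ)
    (h₁ : ∀ v : ℝ, 0 ≤ v → v ≤ 1 → θ v = 0)
    (h₂ : ∀ v : ℝ, 1 ≤ v → v ≤ Real.sqrt 2 → θ v = v ^ 2 - 1)
    (h₃ : ∀ v : ℝ, Real.sqrt 2 ≤ v → θ v = v ^ 4 / 4) :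
    (∀ u : ℝ, 0 ≤ u →
      (u ≤ 1 →
        IsLUB {x : ℝ | ∃ v : ℝ, 0 < v ∧ x = (u * v) ^ 2 - θ v} (u ^ 2)) ∧
      (1 ≤ u →
        IsLUB {x : ℝ | ∃ v : ℝ, 0 < v ∧ x = (u * v) ^ 2 - θ v} (u ^ 4))) := by
  have hs : Real.sqrt 2 ^ 2 = 2 := Real.sq_sqrt (by norm_num)
  have hs0 : 0 < Real.sqrt 2 := by positivity
  intro u hu
  constructor
  · intro hu1
    have hu2 : u ^ 2 ≤ 1 := by nlinarith
    have hu0 : 0 ≤ u ^ 2 := sq_nonneg u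
    refine IsGreatest.isLUB ⟨⟨1, one_pos, ?_⟩, ?_⟩
    · rw [h₁ 1 (by norm_num) le_rfl]; ring
    · rintro x ⟨v, hv, rfl⟩
      rw [mul_pow]
      rcases le_total v 1 with h | h
      · rw [h₁ v hv.le h]
        have : v ^ 2 ≤ 1 := by nlinarith
        nlinarith
      · have hv2 : 1 ≤ v ^ 2 := by nlinarith
        rcases le_total v (Real.sqrt 2) with h' | h'
        · rw [h₂ v h h']
          nlinarith
        · rw [h₃ v h']
          nlinarith [sq_nonneg (v ^ 2 - 2)]
  · intro hu1
    have hu2 : 1 ≤ u ^ 2 := by nlinarith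
    refine IsGreatest.isLUB ⟨⟨Real.sqrt 2 * u, by positivity, ?_⟩, ?_⟩
    · rw [h₃ _ (by nlinarith)]
      have : Real.sqrt 2 ^ 4 = 4 := by
        rw [show Real.sqrt 2 ^ 4 = (Real.sqrt 2 ^ 2) ^ 2 by ring, hs]; norm_num
      rw [mul_pow, mul_pow, mul_pow, hs, this]; ring
    · rintro x ⟨v, hv, rfl⟩
      rw [mul_pow]
      rcases le_total v 1 with h | h
      · rw [h₁ v hv.le h]
        have : v ^ 2 ≤ 1 := by nlinarith
        nlinarith
      · have hv2 : 1 ≤ v ^ 2 := by nlinarith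
        rcases le_total v (Real.sqrt 2) with h' | h'
        · rw [h₂ v h h']
          have : v ^ 2 ≤ 2 := by nlinarith
          nlinarith [sq_nonneg (u ^ 2 - 1)]
        · rw [h₃ v h']
          nlinarith [sq_nonneg (v ^ 2 - 2 * u ^ 2)]

theorem stmt14 (θ : ℝ → ℝ)
    (h₁ : ∀ v : ℝ, 0 ≤ v → v ≤ 1 → θ v = 0)
    (h₂ : ∀ v : ℝ, 1 ≤ v → v ≤ Real.sqrt 2 → θ v = v ^ 2 - 1)
    (h₃ : ∀ v : ℝ, Real.sqrt 2 ≤ v → θ v = v ^ 4 / 4) :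
    (∀ u : ℝ, 0 ≤ u →
      (u ≤ 1 →
        IsLUB {x : ℝ | ∃ v : ℝ, 0 < v ∧ x = (u * v) ^ 2 - θ v} (u ^ 2)) ∧
      (1 ≤ u →
        IsLUB {x : ℝ | ∃ v : ℝ, 0 < v ∧ x = (u * v) ^ 2 - θ v} (u ^ 4))) ∧
    (∀ p : ℝ, 1 ≤ p → p < 2 → ∀ φp : ℝ → ℝ,
      (∀ v : ℝ, 0 ≤ v → v ≤ 1 → φp v = v ^ p) →
      (∀ v : ℝ, 1 ≤ v → φp v = v ^ (4 : ℕ)) →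
      ∀ u : ℝ, 0 < u → u < 1 →
        ominusR (fun t => t ^ 2) (ominusR (fun t => t ^ 2) φp) u ≠ φp u) := by
  refine ⟨part_one θ h₁ h₂ h₃, ?_⟩
  intro p hp1 hp2 φp hφ1 hφ2 u hu0 hu1
  have hs : Real.sqrt 2 ^ 2 = 2 := Real.sq_sqrt (by norm_num)
  have hs0 : 0 < Real.sqrt 2 := by positivity
  have lo : ∀ v : ℝ, 0 < v → v ≤ 1 → v ^ 2 ≤ φp v := by
    intro v hv hv1
    rw [hφ1 v hv.le hv1, ← Real.rpow_natCast]
    exact Real.rpow_le_rpow_of_exponent_ge hv hv1 (by push_cast; exact hp2.le)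
  have hi : ∀ v : ℝ, 0 < v → v ≤ 1 → φp v ≤ v := by
    intro v hv hv1
    rw [hφ1 v hv.le hv1]
    have := Real.rpow_le_rpow_of_exponent_ge hv hv1 hp1
    rwa [Real.rpow_one] at this
  have key := part_one (ominusR (fun t => t ^ 2) φp) ?_ ?_ ?_
  · have h := ((key u hu0.le).1 hu1.le).csSup_eq ⟨_, 1, one_pos, rfl⟩
    have h' : ominusR (fun t => t ^ 2) (ominusR (fun t => t ^ 2) φp) u = u ^ 2 := h
    rw [h', hφ1 u hu0.le hu1.le, ← Real.rpow_natCast]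
    exact (Real.rpow_lt_rpow_of_exponent_gt hu0 hu1 (by push_cast; exact hp2)).ne
  · intro w hw0 hw1
    have hw2 : w ^ 2 ≤ 1 := by nlinarith
    refine IsLUB.csSup_eq ⟨?_, ?_⟩ ⟨_, 1, one_pos, rfl⟩
    · rintro x ⟨v, hv, rfl⟩
      simp only [mul_pow]
      rcases le_total v 1 with h | h
      · have := lo v hv h
        nlinarith [sq_nonneg v]
      · rw [hφ2 v h]
        have : 1 ≤ v ^ 2 := by nlinarith
        nlinarith
    · intro b hb
      by_contra! hb0
      have hm : 0 < min 1 (-b / 2) := lt_min one_pos (by linarith)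
      have h1 := hb ⟨min 1 (-b / 2), hm, rfl⟩
      have h2 := hi _ hm (min_le_left _ _)
      have h3 := min_le_right 1 (-b / 2)
      have h4 := sq_nonneg (w * min 1 (-b / 2))
      simp only at h1
      linarith
  · intro w hw1 hw2
    have hw3 : 1 ≤ w ^ 2 := by nlinarith
    have hw4 : w ^ 2 ≤ 2 := by nlinarith
    refine IsLUB.csSup_eq (IsGreatest.isLUB ⟨⟨1, one_pos, ?_⟩, ?_⟩) ⟨_, 1, one_pos, rfl⟩
    · rw [hφ2 1 le_rfl]; ring
    · rintro x ⟨v, hv, rfl⟩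
      simp only [mul_pow]
      rcases le_total v 1 with h | h
      · have := lo v hv h
        have : v ^ 2 ≤ 1 := by nlinarith
        nlinarith
      · rw [hφ2 v h]
        have : 1 ≤ v ^ 2 := by nlinarith
        nlinarith
  · intro w hw
    have hw2 : 2 ≤ w ^ 2 := by nlinarith
    have hdiv : (w / Real.sqrt 2) ^ 2 = w ^ 2 / 2 := by rw [div_pow, hs]
    have h1 : 1 ≤ w / Real.sqrt 2 := by rwa [one_le_div hs0]
    refine IsLUB.csSup_eq (IsGreatest.isLUB ⟨⟨w / Real.sqrt 2, by linarith, ?_⟩, ?_⟩)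
      ⟨_, 1, one_pos, rfl⟩
    · rw [hφ2 _ h1]
      simp only [mul_pow]
      rw [show (w / Real.sqrt 2) ^ 4 = ((w / Real.sqrt 2) ^ 2) ^ 2 by ring, hdiv]; ring
    · rintro x ⟨v, hv, rfl⟩
      simp only [mul_pow]
      rcases le_total v 1 with h | h
      · have := lo v hv h
        have : v ^ 2 ≤ 1 := by nlinarith
        nlinarith [sq_nonneg (w ^ 2 - 2)]
      · rw [hφ2 v h]
        nlinarith [sq_nonneg (w ^ 2 - 2 * v ^ 2)]
end

section
/- There exist a convex, non-decreasing function ψ : [0,∞) → [0,∞) with ψ(0) = 0 and a strictly increasing sequence (u_n) of positive real numbers tending to ∞ such that: ψ(u) ≥ u²/2 for all u ≥ 0; ψ(u_n) = u_n²/2 for every n; and ψ(2·u_n)/ψ(u_n) → ∞ as n → ∞. In particular, ψ does not satisfy the Δ₂-condition for large arguments. -/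
theorem stmt15 :
    ∃ ψ : ℝ → ℝ, ∃ u : ℕ → ℝ,
      ConvexOn ℝ (Set.Ici 0) ψ ∧
      MonotoneOn ψ (Set.Ici 0) ∧
      ψ 0 = 0 ∧
      StrictMono u ∧ (∀ n, 0 < u n) ∧
      Filter.Tendsto u Filter.atTop Filter.atTop ∧
      (∀ v : ℝ, 0 ≤ v → v ^ 2 / 2 ≤ ψ v) ∧
      (∀ n, ψ (u n) = (u n) ^ 2 / 2) ∧
      Filter.Tendsto (fun n => ψ (2 * u n) / ψ (u n)) Filter.atTop Filter.atTop := by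
  obtain ⟨w, hw⟩ : ∃ w : ℕ → ℝ, w = fun n : ℕ => (n : ℝ) * (n.factorial : ℝ) := ⟨_, rfl⟩
  have hf : ∀ n : ℕ, (1 : ℝ) ≤ (n.factorial : ℝ) := fun n => by
    exact_mod_cast Nat.factorial_pos n
  have w0 : w 0 = 0 := by simp [hw]
  have wge : ∀ n : ℕ, (n : ℝ) ≤ w n := fun n => by
    have := hf n
    have h2 : (0 : ℝ) ≤ n := Nat.cast_nonneg n
    simp only [hw]; nlinarith
  have wrat : ∀ n : ℕ, (n : ℝ) * w n ≤ w (n + 1) := fun n => by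
    have := hf n
    have h2 : (0 : ℝ) ≤ n := Nat.cast_nonneg n
    simp only [hw, Nat.factorial_succ]; push_cast
    nlinarith [mul_nonneg h2 (by linarith : (0 : ℝ) ≤ (n.factorial : ℝ))]
  have wmono : StrictMono w := by
    refine strictMono_nat_of_lt_succ fun n => ?_
    have := hf n
    have h2 : (0 : ℝ) ≤ n := Nat.cast_nonneg n
    simp only [hw, Nat.factorial_succ]; push_cast
    nlinarith [mul_nonneg h2 (by linarith : (0 : ℝ) ≤ (n.factorial : ℝ)),
      mul_nonneg (mul_nonneg h2 h2) (by linarith : (0 : ℝ) ≤ (n.factorial : ℝ))]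
  have wnn : ∀ n, 0 ≤ w n := fun n => (Nat.cast_nonneg n).trans (wge n)
  obtain ⟨L, hL⟩ : ∃ L : ℕ → ℝ → ℝ,
    ∀ k v, L k v = ((w k + w (k + 1)) * v - w k * w (k + 1)) / 2 := ⟨_, fun _ _ => rfl⟩
  have key : ∀ v : ℝ, 0 ≤ v → ∃ m, v ^ 2 / 2 ≤ L m v ∧ ∀ k, L k v ≤ L m v := by
    intro v hv
    have hex : ∃ j, v < w j := by
      obtain ⟨j, hj⟩ := exists_nat_gt v
      exact ⟨j, hj.trans_le (wge j)⟩
    classical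
    obtain ⟨m, hm⟩ : ∃ m, Nat.find hex = m + 1 := by
      refine Nat.exists_eq_succ_of_ne_zero fun h => ?_
      have := Nat.find_spec hex
      rw [h, w0] at this
      linarith
    have h1 : v < w (m + 1) := hm ▸ Nat.find_spec hex
    have h2 : w m ≤ v := not_lt.1 (Nat.find_min hex (by omega))
    have h3 : v ^ 2 / 2 ≤ L m v := by
      rw [hL]; nlinarith
    refine ⟨m, h3, fun k => ?_⟩
    rcases lt_trichotomy k m with h | h | h
    · refine le_trans ?_ h3
      have e1 : w (k + 1) ≤ w m := wmono.monotone h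
      have e2 : w k ≤ w m := wmono.monotone h.le
      rw [hL]
      nlinarith [mul_nonneg (sub_nonneg.2 (e1.trans h2)) (sub_nonneg.2 (e2.trans h2))]
    · rw [h]
    · refine le_trans ?_ h3
      have e1 : w (m + 1) ≤ w k := wmono.monotone h
      have e2 : w k ≤ w (k + 1) := wmono.monotone (Nat.le_succ k)
      rw [hL]
      nlinarith [mul_nonneg (sub_nonneg.2 (h1.le.trans e1))
        (sub_nonneg.2 ((h1.le.trans e1).trans e2))]
  obtain ⟨ψ, hψ⟩ : ∃ ψ : ℝ → ℝ, ∀ v, ψ v = ⨆ k, L k v := ⟨_, fun _ => rfl⟩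
  have le : ∀ v, 0 ≤ v → ∀ k, L k v ≤ ψ v := by
    intro v hv k
    obtain ⟨m, -, hm⟩ := key v hv
    rw [hψ]
    exact le_ciSup (f := fun k => L k v) ⟨L m v, by rintro _ ⟨k, rfl⟩; exact hm k⟩ k
  have att : ∀ v, 0 ≤ v → ∃ m, ψ v = L m v := by
    intro v hv
    obtain ⟨m, -, hm⟩ := key v hv
    exact ⟨m, le_antisymm (by rw [hψ]; exact ciSup_le hm) (le v hv m)⟩
  have lower : ∀ v : ℝ, 0 ≤ v → v ^ 2 / 2 ≤ ψ v := by
    intro v hv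
    obtain ⟨m, h, -⟩ := key v hv
    exact h.trans (le v hv m)
  have touch : ∀ n, ψ (w n) = (w n) ^ 2 / 2 := by
    intro n
    refine le_antisymm ?_ (lower _ (wnn n))
    rw [hψ]
    refine ciSup_le fun k => ?_
    rw [hL]
    rcases le_or_gt n k with h | h
    · have e1 : w n ≤ w k := wmono.monotone h
      have e2 : w k ≤ w (k + 1) := wmono.monotone (Nat.le_succ k)
      nlinarith [mul_nonneg (sub_nonneg.2 e1) (sub_nonneg.2 (e1.trans e2))]
    · have e1 : w (k + 1) ≤ w n := wmono.monotone h
      have e2 : w k ≤ w n := wmono.monotone h.le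
      nlinarith [mul_nonneg (sub_nonneg.2 e1) (sub_nonneg.2 e2)]
  have wpos : ∀ n, 0 < w (n + 1) := fun n => by
    have := wmono (Nat.succ_pos n)
    rwa [w0] at this
  refine ⟨ψ, fun n => w (n + 1), ⟨convex_Ici 0, ?_⟩, ?_, ?_, ?_, wpos, ?_, lower,
    fun n => touch _, ?_⟩
  · intro x hx y hy a b ha hb hab
    obtain ⟨m, hm⟩ := att (a • x + b • y) (convex_Ici (0 : ℝ) hx hy ha hb hab)
    have h1 := mul_le_mul_of_nonneg_left (le x hx m) ha
    have h2 := mul_le_mul_of_nonneg_left (le y hy m) hb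
    rw [hm]
    simp only [smul_eq_mul]
    refine le_trans (le_of_eq ?_) (add_le_add h1 h2)
    simp only [hL]
    obtain rfl : b = 1 - a := by linarith
    ring
  · intro x hx y hy hxy
    obtain ⟨m, hm⟩ := att x hx
    rw [hm]
    refine le_trans ?_ (le y hy m)
    rw [hL, hL]
    have := mul_le_mul_of_nonneg_left hxy (add_nonneg (wnn m) (wnn (m + 1)))
    linarith
  · have := touch 0
    rw [w0] at this
    simpa using this
  · exact fun a b h => wmono (Nat.succ_lt_succ h)
  · refine Filter.tendsto_atTop_mono (fun n => ?_) tendsto_natCast_atTop_atTop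
    exact (wge n).trans (wmono.monotone (Nat.le_succ n))
  · refine Filter.tendsto_atTop_mono (fun n => ?_) tendsto_natCast_atTop_atTop
    have hp := wpos n
    have h1 := le (2 * w (n + 1)) (by linarith) (n + 1)
    have h2 := wrat (n + 1)
    push_cast at h2
    rw [hL] at h1
    simp only [touch]
    rw [le_div_iff₀ (by positivity)]
    refine le_trans ?_ h1
    have h3 := mul_le_mul_of_nonneg_left h2 hp.le
    nlinarith [sq_nonneg (w (n + 1))]
end

section
/- Let (Ω, Σ, μ) be a σ-finite measure space, let 1 ≤ q < p < ∞, and define r by 1/r = 1/q − 1/p. Then for a measurable function x : Ω → ℝ the following are equivalent: (a) for every measurable y : Ω → ℝ with y ∈ L^p(μ), the pointwise product x·y belongs to L^q(μ); (b) x ∈ L^r(μ). -/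
open MeasureTheory in
theorem aux_fin {Ω : Type*} [MeasurableSpace Ω] (μ : Measure Ω) (s : ℝ) (hs : 0 < s)
    (f : Ω → ℝ) (hf : Measurable f) :
    (∫⁻ t, ENNReal.ofReal (|f t| ^ s) ∂μ) < ⊤ ↔ MemLp f (ENNReal.ofReal s) μ := by
  have h1 : ENNReal.ofReal s ≠ 0 := by simpa using hs
  rw [MemLp, and_iff_right hf.aestronglyMeasurable,
    eLpNorm_lt_top_iff_lintegral_rpow_enorm_lt_top h1 ENNReal.ofReal_ne_top,
    ENNReal.toReal_ofReal hs.le]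
  refine Iff.of_eq (congrArg (· < ⊤) (lintegral_congr fun t => ?_))
  rw [← ENNReal.ofReal_rpow_of_nonneg (abs_nonneg _) hs.le, Real.enorm_eq_ofReal_abs]

open MeasureTheory in
theorem aux_v {Ω : Type*} [MeasurableSpace Ω] (ν : Measure Ω) [SigmaFinite ν]
    (hν : ν Set.univ = ⊤) (θ : ℝ) (h0 : 0 < θ) (h1 : θ < 1) :
    ∃ v : Ω → NNReal, Measurable v ∧ (∫⁻ t, (v t : ENNReal) ∂ν) < ⊤ ∧
      (∫⁻ t, (v t : ENNReal) ^ θ ∂ν) = ⊤ := by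
  have hT : ∀ k : ℕ, ∃ T : Set Ω, MeasurableSet T ∧ ((2:ENNReal) ^ k * k) ≤ (ν T) ^ (1 - θ) ∧
      ν T ≠ 0 ∧ ν T < ⊤ := by
    intro k
    obtain ⟨T, hTm, -, hT1, hT2⟩ := Measure.exists_subset_measure_lt_top (μ := ν)
      (r := ((2:ENNReal) ^ k * k) ^ (1 / (1 - θ))) MeasurableSet.univ (by
        rw [hν]
        exact ENNReal.rpow_lt_top_of_nonneg (by apply div_nonneg <;> linarith)
          (ENNReal.mul_ne_top (by simp) (by simp)))
    refine ⟨T, hTm, ?_, (bot_le.trans_lt hT1).ne', hT2⟩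
    have := ENNReal.rpow_le_rpow hT1.le (show 0 ≤ 1 - θ by linarith)
    rwa [← ENNReal.rpow_mul, one_div, inv_mul_cancel₀ (by linarith), ENNReal.rpow_one] at this
  choose T hTm hTk hT0 hTt using hT
  let u : ℕ → Ω → ENNReal := fun k => (T k).indicator (fun _ => (2:ENNReal)⁻¹ ^ k * (ν (T k))⁻¹)
  have hu : ∀ k, Measurable (u k) := fun k => measurable_const.indicator (hTm k)
  let V : Ω → ENNReal := fun t => ∑' k, u k t
  have hV : Measurable V := Measurable.ennreal_tsum hu
  have hVi : ∫⁻ t, V t ∂ν < ⊤ := by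
    rw [lintegral_tsum fun k => (hu k).aemeasurable]
    have : ∀ k, ∫⁻ t, u k t ∂ν = (2:ENNReal)⁻¹ ^ k := by
      intro k
      rw [lintegral_indicator_const (hTm k), mul_assoc, ENNReal.inv_mul_cancel (hT0 k) (hTt k).ne,
        mul_one]
    simp_rw [this, ENNReal.tsum_geometric]
    simp
  have hae : ∀ᵐ t ∂ν, V t < ⊤ := ae_lt_top hV hVi.ne
  have hae2 : ∀ᵐ t ∂ν, (((V t).toNNReal : NNReal) : ENNReal) = V t := by
    filter_upwards [hae] with t ht using ENNReal.coe_toNNReal ht.ne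
  refine ⟨fun t => (V t).toNNReal, hV.ennreal_toNNReal, ?_, ?_⟩
  · rwa [lintegral_congr_ae hae2]
  · rw [lintegral_congr_ae (g := fun t => V t ^ θ) (by
      filter_upwards [hae2] with t ht
      rw [ht])]
    refine ENNReal.eq_top_of_forall_nnreal_le fun c => ?_
    obtain ⟨k, hk⟩ := exists_nat_ge c
    have hk' : (c : ENNReal) ≤ k := by exact_mod_cast hk
    refine hk'.trans ?_
    calc (k : ENNReal) = (2:ENNReal)⁻¹ ^ k * (2 ^ k * k) := by
          rw [← mul_assoc, ← mul_pow, ENNReal.inv_mul_cancel (by simp) (by simp), one_pow, one_mul]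
      _ ≤ ((2:ENNReal)⁻¹ ^ k) ^ θ * (ν (T k)) ^ (1 - θ) := by
          refine mul_le_mul' ?_ (hTk k)
          have hle : (2:ENNReal)⁻¹ ^ k ≤ 1 := pow_le_one₀ (by simp) (by simp)
          simpa using ENNReal.rpow_le_rpow_of_exponent_ge hle h1.le
      _ = ((2:ENNReal)⁻¹ ^ k * (ν (T k))⁻¹) ^ θ * ν (T k) := by
          rw [ENNReal.mul_rpow_of_nonneg _ _ h0.le, mul_assoc, ENNReal.inv_rpow,
            ← ENNReal.rpow_neg]
          congr 1
          conv_rhs => rw [← ENNReal.rpow_one (ν (T k)), ← ENNReal.rpow_mul,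
            ← ENNReal.rpow_add _ _ (hT0 k) (hTt k).ne]
          congr 1
          ring
      _ = ∫⁻ t, (T k).indicator (fun _ => ((2:ENNReal)⁻¹ ^ k * (ν (T k))⁻¹) ^ θ) t ∂ν := by
          rw [lintegral_indicator_const (hTm k)]
      _ ≤ ∫⁻ t, V t ^ θ ∂ν := by
          refine lintegral_mono fun t => ?_
          by_cases ht : t ∈ T k
          · rw [Set.indicator_of_mem ht]
            refine ENNReal.rpow_le_rpow ?_ h0.le
            have := ENNReal.le_tsum (f := fun k => u k t) k
            simpa [u, ht] using this
          · simp [ht]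

open MeasureTheory in
theorem stmt17 {Ω : Type*} [MeasurableSpace Ω] (μ : Measure Ω) [SigmaFinite μ]
    (p q r : ℝ) (hq : 1 ≤ q) (hqp : q < p)
    (hr : 1 / r = 1 / q - 1 / p)
    (x : Ω → ℝ) (hx : Measurable x) :
    (∀ y : Ω → ℝ, Measurable y →
      (∫⁻ t, ENNReal.ofReal (|y t| ^ p) ∂μ) < ⊤ →
      (∫⁻ t, ENNReal.ofReal (|x t * y t| ^ q) ∂μ) < ⊤) ↔
    (∫⁻ t, ENNReal.ofReal (|x t| ^ r) ∂μ) < ⊤ := by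
  have hq0 : 0 < q := by linarith
  have hp0 : 0 < p := by linarith
  have hr0 : 0 < r := by
    rw [← one_div_pos, hr, sub_pos]
    exact one_div_lt_one_div_of_lt hq0 hqp
  constructor
  · intro h
    by_contra hc
    have hc : (∫⁻ t, ENNReal.ofReal (|x t| ^ r) ∂μ) = ⊤ := by simpa using hc
    have hm : Measurable fun t => |x t| ^ r := by fun_prop
    let ν := μ.withDensity fun t => ENNReal.ofReal (|x t| ^ r)
    haveI : SigmaFinite ν := SigmaFinite.withDensity_ofReal _
    obtain ⟨v, hv, hv1, hv2⟩ := aux_v ν (by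
      simp only [ν]
      rw [withDensity_apply _ MeasurableSet.univ, Measure.restrict_univ, hc]) (q / p)
      (by positivity) ((div_lt_one hp0).2 hqp)
    rw [lintegral_withDensity_eq_lintegral_mul _ hm.ennreal_ofReal (by fun_prop)] at hv1 hv2
    refine (h (fun t => ((v t : ℝ) * |x t| ^ r) ^ (1 / p)) (by fun_prop) ?_).ne ?_
    · convert hv1 using 3 with t
      have h1 : 0 ≤ (v t : ℝ) * |x t| ^ r := by positivity
      rw [abs_of_nonneg (by positivity), ← Real.rpow_mul h1, one_div, inv_mul_cancel₀ hp0.ne',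
        Real.rpow_one, ENNReal.ofReal_mul (by positivity), mul_comm]
      simp
    · rw [← hv2]
      refine lintegral_congr fun t => ?_
      have h1 : 0 ≤ (v t : ℝ) * |x t| ^ r := by positivity
      have h2 : |x t * ((v t : ℝ) * |x t| ^ r) ^ (1 / p)| ^ q
          = |x t| ^ r * (v t : ℝ) ^ (q / p) := by
        rw [abs_mul, abs_of_nonneg (a := ((v t : ℝ) * |x t| ^ r) ^ (1 / p)) (by positivity),
          Real.mul_rpow (by positivity) (by positivity), ← Real.rpow_mul h1,
          Real.mul_rpow (by positivity) (by positivity), ← Real.rpow_mul (abs_nonneg _),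
          mul_left_comm, ← Real.rpow_add_of_nonneg (abs_nonneg _) (by positivity) (by positivity),
          mul_comm]
        have : q + r * (1 / p * q) = r := by
          field_simp at hr ⊢
          linarith
        rw [this, one_div_mul_eq_div]
      rw [h2, ENNReal.ofReal_mul (by positivity), 
        ← ENNReal.ofReal_rpow_of_nonneg (NNReal.coe_nonneg _) (by positivity)]
      simp
  · intro h y hy hyp
    rw [aux_fin μ _ hr0 x hx] at h
    rw [aux_fin μ _ hp0 y hy] at hyp
    rw [aux_fin μ _ hq0 (fun t => x t * y t) (hx.mul hy)]
    haveI : ENNReal.HolderTriple (ENNReal.ofReal r) (ENNReal.ofReal p) (ENNReal.ofReal q) := by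
      constructor
      rw [← ENNReal.ofReal_inv_of_pos hr0, ← ENNReal.ofReal_inv_of_pos hp0,
        ← ENNReal.ofReal_inv_of_pos hq0, ← ENNReal.ofReal_add (by positivity) (by positivity)]
      congr 1
      simp only [one_div] at hr
      linarith
    exact MemLp.mul' hyp h
end

section
/- Consider Lebesgue measure on I = (0,∞). For a measurable function x : I → ℝ the following are equivalent: (a) for every y ∈ L²(I), the pointwise product x·y can be written as x·y = g + h almost everywhere with g ∈ L¹(I) and h ∈ L^∞(I); (b) x can be written as x = x₁ + x₂ almost everywhere with x₁ ∈ L²(I) and x₂ ∈ L^∞(I). -/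
open MeasureTheory in
lemma aux_set (x : ℝ → ℝ) (hx : Measurable x) (M S : ℝ) (hS : 0 ≤ S)
    (h : ∫⁻ t in {t | M < |x t|}, ENNReal.ofReal ((x t) ^ 2) ∂(volume.restrict (Set.Ioi (0 : ℝ))) = ⊤) :
    ∃ A : Set ℝ, MeasurableSet A ∧ A ⊆ {t | M < |x t|} ∧
      ∫⁻ t in A, ENNReal.ofReal ((x t) ^ 2) ∂(volume.restrict (Set.Ioi (0 : ℝ))) =
        ENNReal.ofReal S := by
  set μ := (volume.restrict (Set.Ioi (0 : ℝ))) with hμ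
  have hmx : Measurable fun t => ENNReal.ofReal ((x t) ^ 2) := by fun_prop
  set ν := μ.withDensity (fun t => ENNReal.ofReal ((x t) ^ 2)) with hν
  have hνA : ∀ A, MeasurableSet A → ν A = ∫⁻ t in A, ENNReal.ofReal ((x t) ^ 2) ∂μ :=
    fun A hA => withDensity_apply _ hA
  have habs : Measurable fun t => |x t| := by fun_prop
  let B : ℕ → Set ℝ := fun k => {t | M < |x t|} ∩ {t | |x t| ≤ k}
  have hB : ∀ k, MeasurableSet (B k) := fun k =>
    (measurableSet_lt measurable_const habs).inter (measurableSet_le habs measurable_const)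
  let C : ℕ → Set ℝ := fun k => B k ∩ Set.Iic (k : ℝ)
  have hCmono : Monotone C := by
    intro i j hij t ht
    have hij' : (i : ℝ) ≤ j := by exact_mod_cast hij
    exact ⟨⟨ht.1.1, le_trans ht.1.2 hij'⟩, le_trans ht.2 hij'⟩
  have hU : (⋃ k, C k) = {t | M < |x t|} := by
    ext t
    simp only [Set.mem_iUnion]
    constructor
    · rintro ⟨k, hk⟩; exact hk.1.1
    · intro ht
      obtain ⟨k, hk⟩ := exists_nat_ge (max (|x t|) t)
      exact ⟨k, ⟨ht, le_trans (le_max_left _ _) hk⟩, le_trans (le_max_right _ _) hk⟩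
  have htend := tendsto_measure_iUnion_atTop (μ := ν) hCmono
  rw [hU, hνA _ (measurableSet_lt measurable_const habs), h] at htend
  obtain ⟨k, hk⟩ := (htend.eventually (lt_mem_nhds (ENNReal.ofReal_lt_top (r := S)))).exists
  let f : ℝ → ℝ := (B k).indicator (fun t => (x t) ^ 2)
  have hfm : Measurable f := Measurable.indicator (by fun_prop) (hB k)
  have hf0 : ∀ t, 0 ≤ f t := fun t => Set.indicator_nonneg (fun _ _ => sq_nonneg _) _
  have hfb : ∀ t, ‖f t‖ ≤ (k : ℝ) ^ 2 := by
    intro t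
    rw [Real.norm_of_nonneg (hf0 t)]
    by_cases ht : t ∈ B k
    · simp only [f, Set.indicator_of_mem ht]
      have : |x t| ≤ k := ht.2
      rw [← sq_abs]; gcongr
    · simp only [f, Set.indicator_of_notMem ht]; positivity
  have hfi : ∀ a b : ℝ, IntervalIntegrable f volume a b := by
    intro a b
    refine (intervalIntegrable_const (c := (k : ℝ) ^ 2)).mono_fun hfm.aestronglyMeasurable ?_
    refine Filter.Eventually.of_forall fun t => ?_
    rw [Real.norm_of_nonneg (by positivity : (0 : ℝ) ≤ (k : ℝ) ^ 2)]; exact hfb t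
  have hcont := intervalIntegral.continuous_primitive hfi 0
  have hval : ∀ r : ℝ, 0 ≤ r → ν (B k ∩ Set.Iic r) = ENNReal.ofReal (∫ t in (0:ℝ)..r, f t) := by
    intro r hr
    rw [intervalIntegral.integral_of_le hr, ofReal_integral_eq_lintegral_ofReal
      ((intervalIntegrable_iff_integrableOn_Ioc_of_le hr).1 (hfi 0 r))
      (Filter.Eventually.of_forall hf0), hνA _ ((hB k).inter measurableSet_Iic), hμ,
      Measure.restrict_restrict ((hB k).inter measurableSet_Iic)]
    have : ∀ t, ENNReal.ofReal (f t) = (B k).indicator (fun t => ENNReal.ofReal ((x t) ^ 2)) t := by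
      intro t
      by_cases ht : t ∈ B k <;> simp [f, ht]
    simp_rw [this]
    rw [lintegral_indicator (hB k), Measure.restrict_restrict (hB k)]
    congr 2
    ext t; simp only [Set.mem_inter_iff, Set.mem_Iic, Set.mem_Ioi, Set.mem_Ioc]; tauto
  have hk0 : (0 : ℝ) ≤ k := by positivity
  have hk2 : S ≤ ∫ t in (0:ℝ)..k, f t := by
    have hk' : ENNReal.ofReal S < ν (B k ∩ Set.Iic (k : ℝ)) := hk
    rw [hval _ hk0] at hk'
    exact (ENNReal.ofReal_lt_ofReal_iff'.1 hk').1.le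
  obtain ⟨r, hr, hr2⟩ := intermediate_value_Icc hk0 hcont.continuousOn
    (show S ∈ Set.Icc _ _ from ⟨by simpa using hS, hk2⟩)
  refine ⟨B k ∩ Set.Iic r, (hB k).inter measurableSet_Iic, fun t ht => ht.1.1, ?_⟩
  rw [← hνA _ ((hB k).inter measurableSet_Iic), hval r hr.1]
  exact congrArg _ hr2

open MeasureTheory in
lemma aux_ba (μ : Measure ℝ) (x : ℝ → ℝ)
    (hb : ∃ x₁ x₂ : ℝ → ℝ, Measurable x₁ ∧ Measurable x₂ ∧
      (∀ᵐ t ∂μ, x t = x₁ t + x₂ t) ∧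
      (∫⁻ t, ENNReal.ofReal ((x₁ t) ^ 2) ∂μ) < ⊤ ∧
      (∃ M : ℝ, ∀ᵐ t ∂μ, |x₂ t| ≤ M)) (y : ℝ → ℝ) (hy : Measurable y)
      (hy2 : (∫⁻ t, ENNReal.ofReal ((y t) ^ 2) ∂μ) < ⊤) :
      ∃ g h : ℝ → ℝ, Measurable g ∧ Measurable h ∧
        (∀ᵐ t ∂μ, x t * y t = g t + h t) ∧
        (∫⁻ t, ENNReal.ofReal |g t| ∂μ) < ⊤ ∧
        (∃ M : ℝ, ∀ᵐ t ∂μ, |h t| ≤ M) := by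
  obtain ⟨x₁, x₂, h1, h2, hadd, hL, M, hM⟩ := hb
  have hset : MeasurableSet {t | |y t| ≤ 1} := measurableSet_le (by fun_prop) measurable_const
  refine ⟨fun t => x₁ t * y t + {t | |y t| ≤ 1}ᶜ.indicator (fun t => x₂ t * y t) t,
    {t | |y t| ≤ 1}.indicator (fun t => x₂ t * y t),
    (h1.mul hy).add ((h2.mul hy).indicator hset.compl), (h2.mul hy).indicator hset, ?_, ?_, |M|, ?_⟩
  · filter_upwards [hadd] with t ht
    by_cases hs : |y t| ≤ 1
    · simp [ht, hs]; ring
    · simp [ht, hs]; ring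
  · refine lt_of_le_of_lt (b := ∫⁻ t, (ENNReal.ofReal ((x₁ t) ^ 2) +
      ENNReal.ofReal (1 + |M|) * ENNReal.ofReal ((y t) ^ 2)) ∂μ) (lintegral_mono_ae ?_) ?_
    · filter_upwards [hM] with t ht
      rw [← ENNReal.ofReal_mul (by positivity), ← ENNReal.ofReal_add (by positivity) (by positivity)]
      apply ENNReal.ofReal_le_ofReal
      have e1 : |x₁ t * y t| ≤ x₁ t ^ 2 + y t ^ 2 := by
        rw [abs_le]; constructor <;> nlinarith [sq_nonneg (x₁ t + y t), sq_nonneg (x₁ t - y t)]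
      have e2 : |{t | |y t| ≤ 1}ᶜ.indicator (fun t => x₂ t * y t) t| ≤ |M| * y t ^ 2 := by
        by_cases hs : |y t| ≤ 1
        · simp [hs]; positivity
        · have : |x₂ t| * |y t| ≤ |M| * y t ^ 2 := by
            apply mul_le_mul (ht.trans (le_abs_self _)) _ (abs_nonneg _) (abs_nonneg _)
            rw [← sq_abs]; nlinarith
          simpa [hs, abs_mul] using this
      refine (abs_add_le _ _).trans ?_
      linarith
    · rw [lintegral_add_left (by fun_prop), lintegral_const_mul _ (by fun_prop)]
      exact ENNReal.add_lt_top.2 ⟨hL, ENNReal.mul_lt_top ENNReal.ofReal_lt_top hy2⟩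
  · filter_upwards [hM] with t ht
    by_cases hs : |y t| ≤ 1
    · have : |x₂ t| * |y t| ≤ |M| * 1 :=
        mul_le_mul (ht.trans (le_abs_self _)) hs (abs_nonneg _) (abs_nonneg _)
      simpa [hs, abs_mul] using this
    · simp [hs]

open MeasureTheory in
theorem stmt19 (x : ℝ → ℝ) (hx : Measurable x) :
    (∀ y : ℝ → ℝ, Measurable y →
      (∫⁻ t, ENNReal.ofReal ((y t) ^ 2) ∂(volume.restrict (Set.Ioi (0 : ℝ)))) < ⊤ →
      ∃ g h : ℝ → ℝ, Measurable g ∧ Measurable h ∧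
        (∀ᵐ t ∂(volume.restrict (Set.Ioi (0 : ℝ))), x t * y t = g t + h t) ∧
        (∫⁻ t, ENNReal.ofReal |g t| ∂(volume.restrict (Set.Ioi (0 : ℝ)))) < ⊤ ∧
        (∃ M : ℝ, ∀ᵐ t ∂(volume.restrict (Set.Ioi (0 : ℝ))), |h t| ≤ M)) ↔
    (∃ x₁ x₂ : ℝ → ℝ, Measurable x₁ ∧ Measurable x₂ ∧
      (∀ᵐ t ∂(volume.restrict (Set.Ioi (0 : ℝ))), x t = x₁ t + x₂ t) ∧
      (∫⁻ t, ENNReal.ofReal ((x₁ t) ^ 2) ∂(volume.restrict (Set.Ioi (0 : ℝ)))) < ⊤ ∧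
      (∃ M : ℝ, ∀ᵐ t ∂(volume.restrict (Set.Ioi (0 : ℝ))), |x₂ t| ≤ M)) := by
  refine ⟨fun ha => ?_, fun hb y hy hy2 => aux_ba _ x hb y hy hy2⟩
  by_contra hnb
  have hinf : ∀ M : ℝ, 0 ≤ M → ∫⁻ t in {t | M < |x t|}, ENNReal.ofReal ((x t) ^ 2)
      ∂(volume.restrict (Set.Ioi (0 : ℝ))) = ⊤ := by
    intro M hM0
    by_contra hne
    have hs : MeasurableSet {t | M < |x t|} := measurableSet_lt measurable_const (by fun_prop)
    refine hnb ⟨{t | M < |x t|}.indicator x, {t | M < |x t|}ᶜ.indicator x, hx.indicator hs,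
      hx.indicator hs.compl, Filter.Eventually.of_forall fun t => ?_, ?_, M,
      Filter.Eventually.of_forall fun t => ?_⟩
    · exact (Set.indicator_self_add_compl_apply _ _ _).symm
    · rw [← lintegral_indicator hs] at hne
      refine lt_of_le_of_lt (le_of_eq (lintegral_congr fun t => ?_)) (lt_top_iff_ne_top.2 hne)
      by_cases ht : M < |x t| <;> simp [ht]
    · by_cases ht : M < |x t|
      · simp [ht, hM0]
      · have ht2 := not_lt.1 ht
        simp [ht, ht2]
  choose A hAm hAs hAi using fun n : ℕ =>
    aux_set x hx (2 ^ n) (3 ^ n) (by positivity) (hinf (2 ^ n) (by positivity))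
  set μ := (volume.restrict (Set.Ioi (0 : ℝ))) with hμ
  let c : ℕ → ENNReal := fun n => ENNReal.ofReal ((1 / 4) ^ n)
  let W : ℝ → ENNReal := fun t => ∑' n, (A n).indicator (fun _ => c n) t
  have hWm : Measurable W :=
    Measurable.ennreal_tsum fun n => measurable_const.indicator (hAm n)
  have hWtop : ∀ t, W t ≠ ⊤ := by
    intro t
    have : W t ≤ ∑' n, c n := ENNReal.tsum_le_tsum fun n => Set.indicator_le_self' (by simp) t
    refine ne_top_of_le_ne_top ?_ this
    have hsum : Summable fun n : ℕ => ((1:ℝ) / 4) ^ n :=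
      summable_geometric_of_lt_one (by norm_num) (by norm_num)
    rw [← ENNReal.ofReal_tsum_of_nonneg (fun n => by positivity) hsum]
    exact ENNReal.ofReal_ne_top
  have hWge : ∀ n, ∀ t ∈ A n, ((1:ℝ) / 2) ^ n ≤ Real.sqrt (W t).toReal := by
    intro n t ht
    apply Real.le_sqrt_of_sq_le
    have h1 : c n ≤ W t := by
      have := ENNReal.le_tsum (f := fun n => (A n).indicator (fun _ => c n) t) n
      simpa [ht] using this
    have h2 := (ENNReal.ofReal_le_iff_le_toReal (hWtop t)).1 h1
    refine le_trans (le_of_eq ?_) h2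
    rw [← pow_mul, mul_comm, pow_mul]; norm_num
  have hyL : ∫⁻ t, ENNReal.ofReal ((x t * Real.sqrt (W t).toReal) ^ 2) ∂μ < ⊤ := by
    have e : ∀ t, ENNReal.ofReal ((x t * Real.sqrt (W t).toReal) ^ 2) =
        ∑' n, c n * (A n).indicator (fun t => ENNReal.ofReal ((x t) ^ 2)) t := by
      intro t
      rw [mul_pow, Real.sq_sqrt ENNReal.toReal_nonneg, ENNReal.ofReal_mul (sq_nonneg _),
        ENNReal.ofReal_toReal (hWtop t), ← ENNReal.tsum_mul_left]
      refine tsum_congr fun n => ?_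
      by_cases ht : t ∈ A n <;> simp [ht, mul_comm]
    simp_rw [e]
    have hmx : Measurable fun t => ENNReal.ofReal ((x t) ^ 2) := by fun_prop
    rw [lintegral_tsum fun n => ((hmx.indicator (hAm n)).const_mul _).aemeasurable]
    have e2 : ∀ n, ∫⁻ t, c n * (A n).indicator (fun t => ENNReal.ofReal ((x t) ^ 2)) t ∂μ =
        ENNReal.ofReal ((3 / 4) ^ n) := by
      intro n
      rw [lintegral_const_mul _ (hmx.indicator (hAm n)), lintegral_indicator (hAm n), hAi,
        ← ENNReal.ofReal_mul (by positivity), ← mul_pow]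
      norm_num
    simp_rw [e2]
    have hsum : Summable fun n : ℕ => ((3:ℝ) / 4) ^ n :=
      summable_geometric_of_lt_one (by norm_num) (by norm_num)
    rw [← ENNReal.ofReal_tsum_of_nonneg (fun n => by positivity) hsum]
    exact ENNReal.ofReal_lt_top
  obtain ⟨g, h, hg, hh, hadd, hgL, M, hM⟩ := ha (fun t => x t * Real.sqrt (W t).toReal)
    (hx.mul hWm.ennreal_toReal.sqrt) hyL
  have key : ∀ n : ℕ, 2 * M ≤ 2 ^ n →
      ENNReal.ofReal ((1 / 2) * (3 / 2) ^ n) ≤ ∫⁻ t, ENNReal.ofReal |g t| ∂μ := by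
    intro n hn
    have hmx : Measurable fun t => ENNReal.ofReal ((x t) ^ 2) := by fun_prop
    calc ENNReal.ofReal ((1 / 2) * (3 / 2) ^ n)
        = ∫⁻ t in A n, ENNReal.ofReal ((1 / 2) * (1 / 2) ^ n) * ENNReal.ofReal ((x t) ^ 2) ∂μ := by
          rw [lintegral_const_mul _ hmx, hAi, ← ENNReal.ofReal_mul (by positivity), mul_assoc,
            ← mul_pow]
          norm_num
      _ ≤ ∫⁻ t in A n, ENNReal.ofReal |g t| ∂μ := by
          refine lintegral_mono_ae ?_
          filter_upwards [ae_restrict_mem (hAm n), ae_restrict_of_ae hadd, ae_restrict_of_ae hM]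
            with t ht h1 h2
          rw [← ENNReal.ofReal_mul (by positivity)]
          apply ENNReal.ofReal_le_ofReal
          have h3 := hWge n t ht
          have h4 : (2:ℝ) ^ n < |x t| := hAs n ht
          have h5 : (2:ℝ) ^ n * 2 ^ n ≤ x t ^ 2 := by
            rw [← sq_abs, sq]; gcongr
          have h6 : (2:ℝ) ^ n ≤ (1 / 2) ^ n * x t ^ 2 := by
            calc (2:ℝ) ^ n = (1 / 2) ^ n * (2 ^ n * 2 ^ n) := by
                  rw [← mul_pow, ← mul_pow]; norm_num
              _ ≤ _ := by gcongr
          have h7 : (1 / 2) ^ n * x t ^ 2 ≤ Real.sqrt (W t).toReal * x t ^ 2 := by gcongr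
          have h8 : Real.sqrt (W t).toReal * x t ^ 2 = g t + h t := by rw [← h1]; ring
          have h9 := le_abs_self (g t)
          have h10 := le_abs_self (h t)
          linarith
      _ ≤ _ := setLIntegral_le_lintegral _ _
  have t1 := (tendsto_pow_atTop_atTop_of_one_lt (by norm_num : (1:ℝ) < 2)).eventually_ge_atTop (2 * M)
  have t2 := (tendsto_pow_atTop_atTop_of_one_lt (by norm_num : (1:ℝ) < 3 / 2)).eventually_gt_atTop
    (2 * (∫⁻ t, ENNReal.ofReal |g t| ∂μ).toReal)
  obtain ⟨n, hn1, hn2⟩ := (t1.and t2).exists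
  have := (ENNReal.ofReal_le_iff_le_toReal hgL.ne).1 (key n hn1)
  linarith
end
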